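/- arXiv:1810.09547 — 3 statements merged into one kernel-verified Lean document; each statement's English description precedes it below -/
import Mathlib

section
/- For all real a, z and real b not equal to any non-positive integer, Kummer's transformation holds: M(a, b, z) = e^z · M(b − a, b, −z). -/
/-- Kummer's confluent hypergeometric function
`M(a,b,z) = ∑ (a)_n / (b)_n · zⁿ/n!`, with `(a)_n` the rising factorial. -/
noncomputable def kummerM (a b z : ℝ) : ℝ :=
  ∑' n : ℕ, ((ascPochhammer ℝ n).eval a / (ascPochhammer ℝ n).eval b) * z ^ n / (n.factorial : ℝ)

open Finset Filter Topology

/-- A Chu–Vandermonde identity for rising factorials. -/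
lemma sum_choose_mul_ascPochhammer_eval {R : Type*} [CommRing R] (n : ℕ) (c b : R) :
    ∑ ij ∈ antidiagonal n, (n.choose ij.1 : R) * ((-1) ^ ij.1 * (ascPochhammer R ij.1).eval c *
      (ascPochhammer R ij.2).eval (b + ij.1)) = (ascPochhammer R n).eval (b - c) := by
  induction n generalizing c b with
  | zero => simp
  | succ n ih =>
    rw [Finset.sum_antidiagonal_choose_succ_mul
      (fun i j => (-1) ^ i * (ascPochhammer R i).eval c * (ascPochhammer R j).eval (b + i))]
    have h₁ : ∑ ij ∈ antidiagonal n, (n.choose ij.1 : R) * ((-1) ^ ij.1 *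
        (ascPochhammer R ij.1).eval c * (ascPochhammer R (ij.2 + 1)).eval (b + ij.1)) =
        (b + n) * (ascPochhammer R n).eval (b - c) := by
      rw [← ih c b, mul_sum]
      refine sum_congr rfl fun ij hij => ?_
      rw [← mem_antidiagonal.1 hij, ascPochhammer_succ_eval]
      push_cast
      ring
    have h₂ : ∑ ij ∈ antidiagonal n, (n.choose ij.2 : R) * ((-1) ^ (ij.1 + 1) *
        (ascPochhammer R (ij.1 + 1)).eval c *
        (ascPochhammer R ij.2).eval (b + (ij.1 + 1 : ℕ))) =
        -c * (ascPochhammer R n).eval (b - c) := by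
      have h := ih (c + 1) (b + 1)
      rw [add_sub_add_right_eq_sub] at h
      rw [← h, mul_sum]
      refine sum_congr rfl fun ij hij => ?_
      rw [← Nat.choose_symm_of_eq_add (mem_antidiagonal.1 hij).symm, ascPochhammer_succ_left]
      simp only [Polynomial.eval_mul, Polynomial.eval_X, Polynomial.eval_comp,
        Polynomial.eval_add, Polynomial.eval_one]
      push_cast
      rw [add_comm (ij.1 : R) 1, ← add_assoc]
      ring
    rw [h₁, h₂, ascPochhammer_succ_eval]
    ring

lemma ascPochhammer_eval_ne_zero {R : Type*} [CommRing R] [IsDomain R] {b : R}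
    (hb : ∀ n : ℕ, b ≠ -(n : R)) (n : ℕ) : (ascPochhammer R n).eval b ≠ 0 := by
  induction n with
  | zero => simp
  | succ n ih =>
    rw [ascPochhammer_succ_eval]
    exact mul_ne_zero ih fun h => hb n (eq_neg_of_add_eq_zero_left h)

lemma ascPochhammer_eval_add {R : Type*} [CommRing R] (m n : ℕ) (b : R) :
    (ascPochhammer R (m + n)).eval b =
      (ascPochhammer R m).eval b * (ascPochhammer R n).eval (b + m) := by
  simp [← ascPochhammer_mul]

lemma summable_kummerM (a b z : ℝ) :
    Summable fun n : ℕ =>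
      ((ascPochhammer ℝ n).eval a / (ascPochhammer ℝ n).eval b) * z ^ n / (n.factorial : ℝ) := by
  have hb : Tendsto (fun n : ℕ => b + (n : ℝ)) atTop atTop :=
    tendsto_atTop_add_const_left _ _ tendsto_natCast_atTop_atTop
  have h₁ : Tendsto (fun n : ℕ => 1 + (a - b) / (b + n)) atTop (𝓝 (1 + 0)) :=
    tendsto_const_nhds.add (hb.const_div_atTop _)
  have h₂ : Tendsto (fun n : ℕ => z / ((n : ℝ) + 1)) atTop (𝓝 0) :=
    (tendsto_atTop_add_const_right _ 1 tendsto_natCast_atTop_atTop).const_div_atTop z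
  have h := (h₁.mul h₂).norm
  rw [mul_zero, norm_zero] at h
  refine summable_of_ratio_norm_eventually_le (r := 1 / 2) (by norm_num) ?_
  filter_upwards [h.eventually_le_const (by norm_num : (0 : ℝ) < 1 / 2),
    hb.eventually_gt_atTop 0] with n hn hbn
  refine le_trans (le_of_eq ?_) (mul_le_mul_of_nonneg_right hn (norm_nonneg _))
  rw [← norm_mul]
  congr 1
  have hq : 1 + (a - b) / (b + n) = (a + n) / (b + n) := by
    field_simp
    ring
  rw [hq, ascPochhammer_succ_eval, ascPochhammer_succ_eval, Nat.factorial_succ, pow_succ]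
  push_cast
  simp only [div_eq_mul_inv, mul_inv]
  ring

/-- Kummer's transformation: `M(a,b,z) = e^z · M(b−a, b, −z)` whenever `b` is not a
non-positive integer. -/
theorem stmt2 (a b z : ℝ) (hb : ∀ n : ℕ, b ≠ -(n : ℝ)) :
    kummerM a b z = Real.exp z * kummerM (b - a) b (-z) := by
  rw [mul_comm, Real.exp_eq_exp_ℝ, NormedSpace.exp_eq_tsum_div, kummerM, kummerM,
    tsum_mul_tsum_eq_tsum_sum_antidiagonal_of_summable_norm (summable_kummerM _ _ _).norm
      (Real.summable_pow_div_factorial z).norm]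
  refine tsum_congr fun n => ?_
  have h := sum_choose_mul_ascPochhammer_eval n (b - a) b
  rw [sub_sub_cancel] at h
  rw [← h, sum_div, sum_mul, sum_div]
  refine sum_congr rfl fun ij hij => ?_
  obtain ⟨i, j⟩ := ij
  obtain rfl : i + j = n := mem_antidiagonal.1 hij
  have hij₀ := ascPochhammer_eval_ne_zero hb (i + j)
  rw [ascPochhammer_eval_add] at hij₀ ⊢
  have hi := left_ne_zero_of_mul hij₀
  have hj := right_ne_zero_of_mul hij₀
  have hc : ((i + j).choose i : ℝ) * i.factorial * j.factorial = (i + j).factorial := by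
    rw [Nat.choose_symm_add]
    exact_mod_cast Nat.add_choose_mul_factorial_mul_factorial i j
  have hf : ((i + j).choose i : ℝ) ≠ 0 := by
    exact_mod_cast (Nat.choose_pos (Nat.le_add_right i j)).ne'
  simp only
  rw [← hc, neg_pow z, pow_add]
  field_simp
end

section
/- (Theorem 2.1, existence of the similarity solution to problem (P).) Let β and δ be real constants with β ≥ max(δ, −1−δ), set α = β − δ, and let k, a, h₀, γ, u_∞ > 0 and λ ≥ 0. Let ξ be the unique positive solution of (k·u_∞/(γ·2^{β+1}·a^{β+δ+2}))·f_λ(z) = z^{β+δ+1}, where f_λ(z) = 1/( (k/(2·a·h₀))·M(α/2 + 1/2, 1/2, z²) + λ·z·M(α/2 + 1, 3/2, z²) ). Set D = (k/(2·a·h₀))·M(−α/2, 1/2, −ξ²) + λ·ξ·M(−α/2 + 1/2, 3/2, −ξ²), C₁ = u_∞·ξ·M(−α/2 + 1/2, 3/2, −ξ²)/D, C₂ = −u_∞·M(−α/2, 1/2, −ξ²)/D, and define u(x,t) = t^{α/2}·[C₁·M(−α/2, 1/2, −η²) + C₂·η·M(−α/2 + 1/2, 3/2, −η²)] with η = x/(2a√t),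 and s(t) = 2ξa√t. Then: (i) ∂u/∂t(x,t) = a²·∂²u/∂x²(x,t) for all t > 0 and 0 < x < s(t); (ii) u(s(t),t) = 0 for all t > 0; (iii) −k·∂u/∂x(s(t),t) = γ·s(t)^β·ṡ(t)^δ·ṡ(t) for all t > 0; (iv) s(0) = 0; (v) k·∂u/∂x(0,t) = (h₀/√t)·(λ·u(0,t) − u_∞·t^{α/2}) for all t > 0. -/
/-- Exponential power series with geometrically bounded coefficients may be differentiated
termwise, which shifts the coefficients. -/
theorem hasDerivAt_tsum_pow_div_factorial {g : ℕ → ℝ} {C R : ℝ}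
    (hg : ∀ n, |g n| ≤ C * R ^ n) (z : ℝ) :
    HasDerivAt (fun z => ∑' n, g n * z ^ n / (n.factorial : ℝ))
      (∑' n, g (n + 1) * z ^ n / (n.factorial : ℝ)) z := by
  have hRn : ∀ n, 0 ≤ C * R ^ n := fun n => (abs_nonneg _).trans (hg n)
  have hterm : ∀ (n : ℕ) (w : ℝ),
      g (n + 1) * ((n + 1 : ℕ) * w ^ n) / ((n + 1).factorial : ℝ)
        = g (n + 1) * w ^ n / (n.factorial : ℝ) := by
    intro n w
    rw [Nat.factorial_succ]
    push_cast
    field_simp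
  set r : ℝ := |z| + 1 with hr
  have hr0 : 0 ≤ r := by positivity
  set v : ℕ → ℝ := fun n => C * R ^ n * (n * r ^ (n - 1)) / (n.factorial : ℝ) with hv
  have hvsum : Summable v := by
    rw [← summable_nat_add_iff 1]
    refine ((Real.summable_pow_div_factorial (R * r)).mul_left (C * R)).congr fun n => ?_
    simp only [hv, Nat.factorial_succ, Nat.add_sub_cancel]
    push_cast
    field_simp
    rw [mul_pow]
    ring
  have hbound : ∀ (n : ℕ) (w : ℝ), w ∈ Metric.ball (0 : ℝ) r →
      ‖g n * (n * w ^ (n - 1)) / (n.factorial : ℝ)‖ ≤ v n := by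
    intro n w hw
    have hw' : |w| ≤ r := by simpa using (mem_ball_zero_iff.1 hw).le
    simp only [hv, norm_div, norm_mul, norm_pow, Real.norm_eq_abs, Nat.abs_cast]
    have := hg n
    have := hRn n
    gcongr
  have hz : z ∈ Metric.ball (0 : ℝ) r := by
    simp [hr]
  have key := hasDerivAt_tsum_of_isPreconnected (u := v)
    (g := fun n w => g n * w ^ n / (n.factorial : ℝ))
    (g' := fun n w => g n * (n * w ^ (n - 1)) / (n.factorial : ℝ))
    hvsum Metric.isOpen_ball (convex_ball (0 : ℝ) r).isPreconnected
    (fun n w _ => ((hasDerivAt_pow n w).const_mul (g n)).div_const _) hbound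
    (y₀ := 0) (by simp [hr]; positivity)
    (summable_of_ne_finset_zero (s := {0}) fun n hn => by
      simp at hn
      simp [hn]) hz
  rw [(Summable.of_norm_bounded hvsum fun n => hbound n z hz).tsum_eq_zero_add] at key
  simpa [hterm, -Nat.cast_add] using key

theorem summable_mul_pow_div_factorial {g : ℕ → ℝ} {C R : ℝ}
    (hg : ∀ n, |g n| ≤ C * R ^ n) (z : ℝ) :
    Summable fun n => g n * z ^ n / (n.factorial : ℝ) := by
  refine .of_norm_bounded ((Real.summable_pow_div_factorial (R * |z|)).mul_left C) fun n => ?_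
  rw [norm_div, norm_mul, norm_pow, mul_pow, ← mul_div_assoc, ← mul_assoc]
  simp only [Real.norm_eq_abs, Nat.abs_cast]
  have := hg n
  gcongr

theorem hasSum_mul_tsum_shift_pow_div_factorial {g : ℕ → ℝ} {z : ℝ}
    (hs : Summable fun n => g (n + 1) * z ^ n / (n.factorial : ℝ)) :
    HasSum (fun n => n * g n * z ^ n / (n.factorial : ℝ))
      (z * ∑' n, g (n + 1) * z ^ n / (n.factorial : ℝ)) := by
  rw [← hasSum_nat_add_iff' 1]
  simp only [Finset.range_one, Finset.sum_singleton, Nat.cast_zero, zero_mul, zero_div, sub_zero]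
  refine (hs.hasSum.mul_left z).congr_fun ?_
  intro n
  rw [Nat.factorial_succ]
  push_cast
  field_simp
  ring

/-- Kummer's differential equation `z M'' + (b - z) M' = a M`. -/
theorem exists_hasDerivAt_kummerM (a : ℝ) {b : ℝ} (hb : 0 < b) :
    ∃ M₁ M₂ : ℝ → ℝ, (∀ z, HasDerivAt (kummerM a b) (M₁ z) z) ∧
      (∀ z, HasDerivAt M₁ (M₂ z) z) ∧
      ∀ z, z * M₂ z = a * kummerM a b z - (b - z) * M₁ z := by
  set g : ℕ → ℝ := fun n => (ascPochhammer ℝ n).eval a / (ascPochhammer ℝ n).eval b with hgdef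
  have hrec : ∀ n, (b + n) * g (n + 1) = (a + n) * g n := by
    intro n
    have h1 : (ascPochhammer ℝ n).eval b ≠ 0 := (ascPochhammer_pos n b hb).ne'
    have h2 : b + n ≠ 0 := by positivity
    simp only [hgdef, ascPochhammer_succ_eval]
    field_simp
  set R : ℝ := |a| / b + 1 with hR
  have hR1 : 1 ≤ R := by rw [hR]; linarith [show 0 ≤ |a| / b by positivity]
  have hstep : ∀ n, |g (n + 1)| ≤ R * |g n| := by
    intro n
    have hbn : 0 < b + n := by positivity
    have h := congrArg abs (hrec n)
    rw [abs_mul, abs_mul, abs_of_pos hbn] at h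
    have h3 : |a + n| ≤ R * (b + n) := by
      have : R * (b + n) = |a| + b + n + |a| / b * n := by
        rw [hR]; field_simp; ring
      rw [this]
      have h4 : |a + n| ≤ |a| + n := by simpa using abs_add_le a (n : ℝ)
      have : 0 ≤ |a| / b * n := by positivity
      linarith
    have h5 : |a + n| * |g n| ≤ R * (b + n) * |g n| := by gcongr
    refine le_of_mul_le_mul_left ?_ hbn
    linarith
  have hg : ∀ n, |g n| ≤ R ^ n := by
    intro n
    induction n with
    | zero => simp [hgdef]
    | succ n ih =>
      calc |g (n + 1)| ≤ R * |g n| := hstep n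
        _ ≤ R * R ^ n := by gcongr
        _ = R ^ (n + 1) := by ring
  have hg₀ : ∀ n, |g n| ≤ 1 * R ^ n := by simpa using hg
  have hg₁ : ∀ n, |g (n + 1)| ≤ R * R ^ n := fun n => (hg (n + 1)).trans_eq (pow_succ' R n)
  have hg₂ : ∀ n, |g (n + 1 + 1)| ≤ R ^ 2 * R ^ n := fun n =>
    (hg (n + 1 + 1)).trans_eq (by ring)
  refine ⟨_, _, fun z => hasDerivAt_tsum_pow_div_factorial hg₀ z, hasDerivAt_tsum_pow_div_factorial hg₁,
    fun z => ?_⟩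
  have s₀ := (summable_mul_pow_div_factorial hg₀ z).hasSum
  have s₁ := summable_mul_pow_div_factorial hg₁ z
  have s₂ := summable_mul_pow_div_factorial hg₂ z
  refine (hasSum_mul_tsum_shift_pow_div_factorial (g := fun n => g (n + 1)) s₂).unique ?_
  have h := ((s₀.mul_left a).sub (s₁.hasSum.mul_left b)).add
    (hasSum_mul_tsum_shift_pow_div_factorial s₁)
  have hval : a * kummerM a b z - (b - z) * ∑' n, g (n + 1) * z ^ n / (n.factorial : ℝ) =
      a * (∑' n, g n * z ^ n / (n.factorial : ℝ)) -
        b * (∑' n, g (n + 1) * z ^ n / (n.factorial : ℝ)) +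
        z * ∑' n, g (n + 1) * z ^ n / (n.factorial : ℝ) := by
    rw [show kummerM a b z = ∑' n, g n * z ^ n / (n.factorial : ℝ) from rfl]
    ring
  rw [hval]
  refine h.congr_fun fun n => ?_
  linear_combination (z ^ n / (n.factorial : ℝ)) * hrec n

theorem kummerM_zero (a b : ℝ) : kummerM a b 0 = 1 := by
  rw [kummerM, tsum_eq_single 0]
  · simp
  · intro n hn
    simp [hn]

/-- `y` solves `y'' = c y + 2 σ η y'`, with `y₁` its derivative. -/
def SolvesHermite (c σ : ℝ) (y y₁ : ℝ → ℝ) : Prop :=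
  ∀ η, HasDerivAt y (y₁ η) η ∧ HasDerivAt y₁ (c * y η + 2 * σ * η * y₁ η) η

theorem exists_solvesHermite_kummerM_even (p σ : ℝ) :
    ∃ y₁, SolvesHermite (4 * σ * p) σ (fun η => kummerM p (1 / 2) (σ * η ^ 2)) y₁ ∧ y₁ 0 = 0 := by
  obtain ⟨M₁, M₂, h₁, h₂, hode⟩ := exists_hasDerivAt_kummerM p (b := 1 / 2) (by norm_num)
  refine ⟨fun η => M₁ (σ * η ^ 2) * (2 * σ * η), fun η => ?_, by simp⟩
  have hz : HasDerivAt (fun η : ℝ => σ * η ^ 2) (2 * σ * η) η :=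
    ((hasDerivAt_pow 2 η).const_mul σ).congr_deriv (by norm_num; ring)
  refine ⟨(h₁ _).comp η hz, ?_⟩
  refine (((h₂ _).comp η hz).mul ((hasDerivAt_id η).const_mul (2 * σ))).congr_deriv ?_
  simp only [Function.comp, id]
  linear_combination 4 * σ * hode (σ * η ^ 2)

theorem exists_solvesHermite_kummerM_odd (p σ : ℝ) :
    ∃ y₁, SolvesHermite (4 * σ * p - 2 * σ) σ
      (fun η => η * kummerM p (3 / 2) (σ * η ^ 2)) y₁ ∧ y₁ 0 = 1 := by
  obtain ⟨M₁, M₂, h₁, h₂, hode⟩ := exists_hasDerivAt_kummerM p (b := 3 / 2) (by norm_num)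
  refine ⟨fun η => kummerM p (3 / 2) (σ * η ^ 2) + M₁ (σ * η ^ 2) * (2 * σ * η ^ 2),
    fun η => ?_, by simp [kummerM_zero]⟩
  have hz : HasDerivAt (fun η : ℝ => σ * η ^ 2) (2 * σ * η) η :=
    ((hasDerivAt_pow 2 η).const_mul σ).congr_deriv (by norm_num; ring)
  have hd := (h₁ _).comp η hz
  refine ⟨((hasDerivAt_id η).mul hd).congr_deriv ?_, ?_⟩
  · simp only [Function.comp, id]
    ring
  refine (hd.add (((h₂ _).comp η hz).mul ((hasDerivAt_pow 2 η).const_mul (2 * σ)))).congr_deriv ?_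
  simp only [Function.comp]
  norm_num
  linear_combination 4 * σ * η * hode (σ * η ^ 2)

theorem SolvesHermite.combination {c σ : ℝ} {y y₁ v v₁ : ℝ → ℝ}
    (hy : SolvesHermite c σ y y₁) (hv : SolvesHermite c σ v v₁) (A B : ℝ) :
    SolvesHermite c σ (fun η => A * y η + B * v η) (fun η => A * y₁ η + B * v₁ η) := fun η =>
  ⟨((hy η).1.const_mul A).add ((hv η).1.const_mul B),
    (((hy η).2.const_mul A).add ((hv η).2.const_mul B)).congr_deriv (by ring)⟩

theorem hasDerivAt_exp_mul_sq (σ η : ℝ) :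
    HasDerivAt (fun η => Real.exp (σ * η ^ 2)) (Real.exp (σ * η ^ 2) * (2 * σ * η)) η :=
  (((hasDerivAt_pow 2 η).const_mul σ).exp).congr_deriv (by norm_num; ring)

/-- Multiplication by `exp (-σ η²)` flips the sign of the drift. -/
theorem SolvesHermite.exp_mul {c σ : ℝ} {y y₁ : ℝ → ℝ} (hy : SolvesHermite c σ y y₁) :
    SolvesHermite (c - 2 * σ) (-σ) (fun η => Real.exp (-σ * η ^ 2) * y η)
      (fun η => Real.exp (-σ * η ^ 2) * (y₁ η - 2 * σ * η * y η)) := fun η => by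
  obtain ⟨h₁, h₂⟩ := hy η
  have he := hasDerivAt_exp_mul_sq (-σ) η
  refine ⟨(he.mul h₁).congr_deriv (by ring), ?_⟩
  refine (he.mul (h₂.sub (((hasDerivAt_id η).const_mul (2 * σ)).mul h₁))).congr_deriv ?_
  simp only [id, Pi.sub_apply, Pi.mul_apply]
  ring

/-- Abel's formula for the Wronskian. -/
theorem SolvesHermite.wronskian {c σ : ℝ} {y y₁ v v₁ : ℝ → ℝ} (hy : SolvesHermite c σ y y₁)
    (hv : SolvesHermite c σ v v₁) (η : ℝ) :
    y η * v₁ η - y₁ η * v η = Real.exp (σ * η ^ 2) * (y 0 * v₁ 0 - y₁ 0 * v 0) := by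
  have hd : ∀ x, HasDerivAt
      (fun x => Real.exp (-σ * x ^ 2) * (y x * v₁ x - y₁ x * v x)) 0 x := fun x => by
    refine ((hasDerivAt_exp_mul_sq (-σ) x).mul
      (((hy x).1.mul (hv x).2).sub ((hy x).2.mul (hv x).1))).congr_deriv ?_
    simp only [Pi.sub_apply, Pi.mul_apply]
    ring
  have h := is_const_of_deriv_eq_zero (fun x => (hd x).differentiableAt)
    (fun x => (hd x).deriv) η 0
  have he : Real.exp (σ * η ^ 2) * Real.exp (-σ * η ^ 2) = 1 := by
    rw [← Real.exp_add, ← Real.exp_zero]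
    congr 1
    ring
  simp only [ne_eq, OfNat.ofNat_ne_zero, not_false_eq_true, zero_pow, mul_zero, Real.exp_zero,
    one_mul] at h
  linear_combination
    Real.exp (σ * η ^ 2) * h - (y η * v₁ η - y₁ η * v η) * he

/-- A solution is determined by its Cauchy data at the origin, given a fundamental system. -/
theorem SolvesHermite.eq_of_fundamental {c σ : ℝ} {y y₁ v v₁ w w₁ : ℝ → ℝ}
    (hy : SolvesHermite c σ y y₁) (hv : SolvesHermite c σ v v₁) (hw : SolvesHermite c σ w w₁)
    (hy0 : y 0 = 1) (hy10 : y₁ 0 = 0) (hv0 : v 0 = 0) (hv10 : v₁ 0 = 1) (η : ℝ) :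
    w η = w 0 * y η + w₁ 0 * v η := by
  have h₁ := hy.wronskian hv η
  have h₂ := hw.wronskian hy η
  have h₃ := hw.wronskian hv η
  simp only [hy0, hy10, hv0, hv10] at h₁ h₂ h₃
  refine mul_left_cancel₀ (Real.exp_pos (σ * η ^ 2)).ne' ?_
  linear_combination y η * h₃ - v η * h₂ - w η * h₁

theorem exists_kummerM_fundamental (α : ℝ) :
    ∃ A₁ B₁ : ℝ → ℝ,
      SolvesHermite (2 * α) (-1) (fun η => kummerM (-α / 2) (1 / 2) (-η ^ 2)) A₁ ∧
      SolvesHermite (2 * α) (-1) (fun η => η * kummerM (-α / 2 + 1 / 2) (3 / 2) (-η ^ 2)) B₁ ∧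
      A₁ 0 = 0 ∧ B₁ 0 = 1 := by
  obtain ⟨A₁, hA, hA0⟩ := exists_solvesHermite_kummerM_even (-α / 2) (-1)
  obtain ⟨B₁, hB, hB0⟩ := exists_solvesHermite_kummerM_odd (-α / 2 + 1 / 2) (-1)
  simp only [neg_one_mul] at hA hB
  refine ⟨A₁, B₁, ?_, ?_, hA0, hB0⟩
  · convert hA using 1
    ring
  · convert hB using 1
    ring

/-- Kummer's transformation for the even solution. -/
theorem kummerM_half_neg_sq (α η : ℝ) :
    kummerM (-α / 2) (1 / 2) (-η ^ 2) =
      Real.exp (-η ^ 2) * kummerM (α / 2 + 1 / 2) (1 / 2) (η ^ 2) := by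
  obtain ⟨A₁, B₁, hA, hB, hA0, hB0⟩ := exists_kummerM_fundamental α
  obtain ⟨P₁, hP, hP0⟩ := exists_solvesHermite_kummerM_even (α / 2 + 1 / 2) 1
  have hw := hP.exp_mul
  rw [show 4 * 1 * (α / 2 + 1 / 2) - 2 * 1 = 2 * α by ring] at hw
  have h := hA.eq_of_fundamental hB hw (by simp [kummerM_zero]) hA0 (by simp) hB0 η
  simpa [kummerM_zero, hP0] using h.symm

/-- Kummer's transformation for the odd solution. -/
theorem mul_kummerM_three_halves_neg_sq (α η : ℝ) :
    η * kummerM (-α / 2 + 1 / 2) (3 / 2) (-η ^ 2) =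
      Real.exp (-η ^ 2) * (η * kummerM (α / 2 + 1) (3 / 2) (η ^ 2)) := by
  obtain ⟨A₁, B₁, hA, hB, hA0, hB0⟩ := exists_kummerM_fundamental α
  obtain ⟨P₁, hP, hP0⟩ := exists_solvesHermite_kummerM_odd (α / 2 + 1) 1
  have hw := hP.exp_mul
  rw [show 4 * 1 * (α / 2 + 1) - 2 * 1 - 2 * 1 = 2 * α by ring] at hw
  have h := hA.eq_of_fundamental hB hw (by simp [kummerM_zero]) hA0 (by simp) hB0 η
  simpa [kummerM_zero, hP0] using h.symm

theorem SolvesHermite.deriv_similarity {c σ : ℝ} {y y₁ : ℝ → ℝ} (hy : SolvesHermite c σ y y₁)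
    (q l : ℝ) : deriv (fun x => q * y (x / l)) = fun x => q * (y₁ (x / l) / l) := by
  funext x
  refine ((((hy (x / l)).1.comp x ((hasDerivAt_id x).div_const l)).const_mul q).congr_deriv
    ?_).deriv
  ring

/-- Similarity solutions of the heat equation. -/
theorem SolvesHermite.heat_equation {α a : ℝ} {y y₁ : ℝ → ℝ}
    (hy : SolvesHermite (2 * α) (-1) y y₁) (ha : a ≠ 0) {t : ℝ} (ht : 0 < t) (x : ℝ) :
    deriv (fun τ => τ ^ (α / 2) * y (x / (2 * a * Real.sqrt τ))) t =
      a ^ 2 * deriv (deriv fun x => t ^ (α / 2) * y (x / (2 * a * Real.sqrt t))) x := by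
  have hr : 0 < Real.sqrt t := Real.sqrt_pos.2 ht
  have hl : 2 * a * Real.sqrt t ≠ 0 := by positivity
  have hr2 : Real.sqrt t ^ 2 = t := Real.sq_sqrt ht.le
  set η := x / (2 * a * Real.sqrt t) with hη
  have hxx : deriv (deriv fun x => t ^ (α / 2) * y (x / (2 * a * Real.sqrt t))) x =
      t ^ (α / 2) * ((2 * α * y η + 2 * -1 * η * y₁ η) / (4 * a ^ 2 * t)) := by
    rw [hy.deriv_similarity]
    refine (((((hy η).2.comp x ((hasDerivAt_id x).div_const _)).div_const _).const_mul
      _).congr_deriv ?_).deriv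
    rw [show 4 * a ^ 2 * t = (2 * a * Real.sqrt t) * (2 * a * Real.sqrt t) by
      linear_combination (-4 * a ^ 2) * hr2]
    field_simp
  have hηt : HasDerivAt (fun τ => x / (2 * a * Real.sqrt τ)) (-η / (2 * t)) t := by
    refine (((Real.hasDerivAt_sqrt ht.ne').const_mul (2 * a)).fun_inv hl |>.const_mul
      x).congr_deriv ?_ |>.congr_of_eventuallyEq (.of_forall fun τ => div_eq_mul_inv _ _)
    rw [hη, ← hr2, Real.sqrt_sq hr.le]
    field_simp
  have htt : deriv (fun τ => τ ^ (α / 2) * y (x / (2 * a * Real.sqrt τ))) t =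
      α / 2 * t ^ (α / 2 - 1) * y η + t ^ (α / 2) * (y₁ η * (-η / (2 * t))) :=
    ((Real.hasDerivAt_rpow_const (.inl ht.ne')).mul ((hy η).1.comp t hηt)).deriv
  rw [hxx, htt, Real.rpow_sub_one ht.ne']
  field_simp
  ring

/-- Theorem 2.1: with `β ≥ max(δ,−1−δ)`, `α = β − δ`, `ξ` the positive root of the
transcendental equation, and `u`, `s` the similarity pair built from `C₁`, `C₂`,
the pair `(u,s)` solves problem (P): heat equation, vanishing at the free boundary,
generalized Stefan condition with latent heat `γ s^β ṡ^δ`, `s(0)=0`, and the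
generalized boundary condition at the fixed face. -/
theorem stmt8 (β δ k a h₀ γ uinf lam : ℝ) (hβ : β ≥ max δ (-1 - δ))
    (hk : 0 < k) (ha : 0 < a) (hh : 0 < h₀) (hγ : 0 < γ) (huinf : 0 < uinf)
    (hlam : 0 ≤ lam) (α : ℝ) (hα : α = β - δ)
    (ξ : ℝ) (hξpos : 0 < ξ)
    (hξ : (k * uinf / (γ * (2:ℝ) ^ (β + 1) * a ^ (β + δ + 2))) *
      (1 / ((k / (2 * a * h₀)) * kummerM (α/2 + 1/2) (1/2) (ξ^2) +
        lam * ξ * kummerM (α/2 + 1) (3/2) (ξ^2))) = ξ ^ (β + δ + 1))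
    (D C₁ C₂ : ℝ)
    (hD : D = (k / (2 * a * h₀)) * kummerM (-α/2) (1/2) (-ξ^2) +
      lam * ξ * kummerM (-α/2 + 1/2) (3/2) (-ξ^2))
    (hC₁ : C₁ = uinf * ξ * kummerM (-α/2 + 1/2) (3/2) (-ξ^2) / D)
    (hC₂ : C₂ = -uinf * kummerM (-α/2) (1/2) (-ξ^2) / D)
    (u : ℝ → ℝ → ℝ)
    (hu : u = fun x t => t ^ (α/2) *
      (C₁ * kummerM (-α/2) (1/2) (-(x / (2 * a * Real.sqrt t))^2) +
       C₂ * (x / (2 * a * Real.sqrt t)) *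
         kummerM (-α/2 + 1/2) (3/2) (-(x / (2 * a * Real.sqrt t))^2)))
    (s : ℝ → ℝ) (hs : s = fun t => 2 * ξ * a * Real.sqrt t) :
    (∀ t x : ℝ, 0 < t → 0 < x → x < s t →
      deriv (fun τ => u x τ) t = a^2 * deriv (deriv (fun y => u y t)) x) ∧
    (∀ t : ℝ, 0 < t → u (s t) t = 0) ∧
    (∀ t : ℝ, 0 < t → -k * deriv (fun y => u y t) (s t) =
      γ * (s t) ^ β * (deriv s t) ^ δ * deriv s t) ∧
    s 0 = 0 ∧
    (∀ t : ℝ, 0 < t → k * deriv (fun y => u y t) 0 =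
      (h₀ / Real.sqrt t) * (lam * u 0 t - uinf * t ^ (α/2))) := by
  obtain ⟨A₁, B₁, hA, hB, hA0, hB0⟩ := exists_kummerM_fundamental α
  set A : ℝ → ℝ := fun η => kummerM (-α / 2) (1 / 2) (-η ^ 2) with hAdef
  set B : ℝ → ℝ := fun η => η * kummerM (-α / 2 + 1 / 2) (3 / 2) (-η ^ 2) with hBdef
  have hy := hA.combination hB C₁ C₂
  set Y : ℝ → ℝ := fun η => C₁ * A η + C₂ * B η with hY
  have huY : u = fun x t => t ^ (α / 2) * Y (x / (2 * a * Real.sqrt t)) := by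
    rw [hu]
    funext x t
    simp only [hY, hAdef, hBdef]
    ring
  set E : ℝ := k / (2 * a * h₀) * kummerM (α / 2 + 1 / 2) (1 / 2) (ξ ^ 2) +
    lam * ξ * kummerM (α / 2 + 1) (3 / 2) (ξ ^ 2) with hE
  have hE0 : E ≠ 0 := by
    intro h
    rw [h, div_zero, mul_zero] at hξ
    exact (Real.rpow_pos_of_pos hξpos _).ne hξ
  have hDE : D = Real.exp (-ξ ^ 2) * E := by
    rw [hD, hE]
    linear_combination (k / (2 * a * h₀)) * kummerM_half_neg_sq α ξ +
      lam * mul_kummerM_three_halves_neg_sq α ξ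
  have he := Real.exp_pos (-ξ ^ 2)
  have hD0 : D ≠ 0 := hDE ▸ mul_ne_zero he.ne' hE0
  have hDAB : D = k / (2 * a * h₀) * A ξ + lam * B ξ := by
    rw [hD]
    simp only [hAdef, hBdef]
    ring
  have hC₁' : C₁ = uinf * B ξ / D := by
    rw [hC₁]
    simp only [hBdef]
    ring
  have hC₂' : C₂ = -uinf * A ξ / D := hC₂
  have hA00 : A 0 = 1 := by simp [hAdef, kummerM_zero]
  have hB00 : B 0 = 0 := by simp [hBdef]
  have hW : A ξ * B₁ ξ - A₁ ξ * B ξ = Real.exp (-ξ ^ 2) := by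
    rw [hA.wronskian hB ξ, hA00, hB00, hA0, hB0]
    simp
  have hη : ∀ t, 0 < t → s t / (2 * a * Real.sqrt t) = ξ := by
    intro t ht
    have hr := Real.sqrt_pos.2 ht
    simp only [hs]
    field_simp
  have hux : ∀ t, deriv (fun y => u y t) = fun x => t ^ (α / 2) *
      ((C₁ * A₁ (x / (2 * a * Real.sqrt t)) + C₂ * B₁ (x / (2 * a * Real.sqrt t))) /
        (2 * a * Real.sqrt t)) := by
    intro t
    rw [huY]
    exact hy.deriv_similarity _ _
  refine ⟨?_, ?_, ?_, ?_, ?_⟩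
  · intro t x ht _ _
    rw [huY]
    exact hy.heat_equation ha.ne' ht x
  · intro t ht
    rw [huY]
    simp only [hη t ht, hY, hC₁', hC₂']
    ring
  · intro t ht
    have hr := Real.sqrt_pos.2 ht
    have hds : deriv s t = ξ * a / Real.sqrt t := by
      rw [hs]
      refine (((Real.hasDerivAt_sqrt ht.ne').const_mul (2 * ξ * a)).congr_deriv ?_).deriv
      field_simp
    have htα : t ^ (α / 2) = Real.sqrt t ^ β / Real.sqrt t ^ δ := by
      rw [← Real.rpow_sub hr, ← hα, Real.sqrt_eq_rpow, ← Real.rpow_mul ht.le]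
      congr 1
      ring
    have hflux : C₁ * A₁ ξ + C₂ * B₁ ξ = -uinf / E := by
      rw [hC₁', hC₂', hDE]
      field_simp
      linear_combination (-1) * hW
    have hst : s t = 2 * ξ * a * Real.sqrt t := by rw [hs]
    rw [hux, hds]
    simp only [hη t ht]
    rw [hflux, hst, htα, Real.mul_rpow (by positivity) hr.le,
      Real.mul_rpow (by positivity) ha.le, Real.mul_rpow (by norm_num) hξpos.le,
      Real.div_rpow (by positivity) hr.le, Real.mul_rpow hξpos.le ha.le]
    rw [Real.rpow_add hξpos, Real.rpow_add hξpos, Real.rpow_one,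
      Real.rpow_add ha, Real.rpow_add ha, Real.rpow_two,
      Real.rpow_add two_pos, Real.rpow_one] at hξ
    have h2β := Real.rpow_pos_of_pos (two_pos : (0 : ℝ) < 2) β
    have haβ := Real.rpow_pos_of_pos ha β
    have haδ := Real.rpow_pos_of_pos ha δ
    have hrδ := Real.rpow_pos_of_pos hr δ
    have hkE : k * uinf / E =
        ξ ^ β * ξ ^ δ * ξ * (γ * (2 ^ β * 2) * (a ^ β * a ^ δ * a ^ 2)) := by
      rw [← hξ]
      field_simp
    calc _ = k * uinf / E *
          (Real.sqrt t ^ β / Real.sqrt t ^ δ / (2 * a * Real.sqrt t)) := by ring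
      _ = _ := by
        rw [hkE]
        field_simp
  · simp [hs]
  · intro t ht
    have hr := Real.sqrt_pos.2 ht
    rw [hux, huY]
    simp only [zero_div, hY, hA00, hB00, hA0, hB0, mul_zero, mul_one, zero_add, add_zero]
    have hC : k / (2 * a * h₀) * C₂ = lam * C₁ - uinf := by
      rw [hC₁', hC₂', eq_sub_iff_add_eq]
      refine mul_right_cancel₀ hD0 ?_
      field_simp
      field_simp at hDAB
      linear_combination hDAB
    have hC' : k * C₂ = 2 * a * h₀ * (lam * C₁ - uinf) := by
      rw [← hC]
      field_simp
    field_simp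
    linear_combination hC'
end

section
/- (Equivalence of the Neumann and Dirichlet problems.) Let β and δ be real constants with β ≥ max(δ, −1−δ), set α = β − δ, and let k, a, γ, q₀ > 0. Let ξ_N be the unique positive solution of (q₀/(γ·2^β·a^{β+δ+1}))·g(z) = z^{β+δ+1}, where g(z) = 1/M(α/2 + 1/2, 1/2, z²). Define u₀ = (2·a·q₀/k)·ξ_N·M(−α/2 + 1/2, 3/2, −ξ_N²)/M(−α/2, 1/2, −ξ_N²). Then the unique positive solution ξ_D of the Dirichlet equation (k·u₀/(γ·2^{β+1}·a^{β+δ+2}))·f(z) = z^{β+δ+1}, with f(z) = 1/(z·M(α/2 + 1, 3/2, z²)), satisfies ξ_D = ξ_N. -/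
open Finset Filter Topology

/-- The `n`-th term of the series defining `kummerM`. -/
noncomputable def kummerTerm (a b z : ℝ) (n : ℕ) : ℝ :=
  ((ascPochhammer ℝ n).eval a / (ascPochhammer ℝ n).eval b) * z ^ n / (n.factorial : ℝ)

theorem ascPochhammer_succ_eval_left (n : ℕ) (a : ℝ) :
    (ascPochhammer ℝ (n + 1)).eval a = a * (ascPochhammer ℝ n).eval (a + 1) := by
  simp [ascPochhammer_succ_left]

/-- A form of the Chu–Vandermonde identity. -/
theorem sum_antidiagonal_choose_mul_ascPochhammer (n : ℕ) (b c : ℝ) :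
    ∑ p ∈ antidiagonal n, (n.choose p.1 : ℝ) *
      ((-1) ^ p.1 * (ascPochhammer ℝ p.1).eval c * (ascPochhammer ℝ p.2).eval (b + p.1)) =
      (ascPochhammer ℝ n).eval (b - c) := by
  induction n generalizing b c with
  | zero => simp
  | succ n ih =>
    rw [Finset.sum_antidiagonal_choose_succ_mul (fun i j : ℕ =>
      (-1 : ℝ) ^ i * (ascPochhammer ℝ i).eval c * (ascPochhammer ℝ j).eval (b + i))]
    have h1 : ∑ p ∈ antidiagonal n, (n.choose p.1 : ℝ) * ((-1) ^ p.1 *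
        (ascPochhammer ℝ p.1).eval c * (ascPochhammer ℝ (p.2 + 1)).eval (b + p.1)) =
        (b + n) * (ascPochhammer ℝ n).eval (b - c) := by
      rw [← ih b c, Finset.mul_sum]
      refine Finset.sum_congr rfl fun p hp => ?_
      rw [← mem_antidiagonal.mp hp, ascPochhammer_succ_eval]
      push_cast
      ring
    have h2 : ∑ p ∈ antidiagonal n, (n.choose p.2 : ℝ) * ((-1) ^ (p.1 + 1) *
        (ascPochhammer ℝ (p.1 + 1)).eval c *
        (ascPochhammer ℝ p.2).eval (b + (p.1 + 1 : ℕ))) =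
        -c * (ascPochhammer ℝ n).eval (b - c) := by
      have h := ih (b + 1) (c + 1)
      rw [add_sub_add_right_eq_sub] at h
      rw [← h, Finset.mul_sum]
      refine Finset.sum_congr rfl fun p hp => ?_
      have hb : b + ((p.1 + 1 : ℕ) : ℝ) = b + 1 + p.1 := by push_cast; ring
      rw [← Nat.choose_symm_of_eq_add (mem_antidiagonal.mp hp).symm,
        ascPochhammer_succ_eval_left, hb]
      ring
    rw [h1, h2, ascPochhammer_succ_eval]
    ring

theorem ascPochhammer_eval_mul_eval_add (m n : ℕ) (b : ℝ) :
    (ascPochhammer ℝ m).eval b * (ascPochhammer ℝ n).eval (b + m) =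
      (ascPochhammer ℝ (m + n)).eval b := by
  rw [← ascPochhammer_mul]
  simp

theorem summable_norm_kummerTerm (a z : ℝ) {b : ℝ} (hb : 0 < b) :
    Summable fun n => ‖kummerTerm a b z n‖ := by
  have hratio (n : ℕ) : kummerTerm a b z (n + 1) =
      (1 + (a - b) / (b + n)) * (z / ((n : ℝ) + 1)) * kummerTerm a b z n := by
    have hbn : b + n ≠ 0 := by positivity
    have hp := (ascPochhammer_pos n b hb).ne'
    rw [kummerTerm, kummerTerm, ascPochhammer_succ_eval, ascPochhammer_succ_eval,
      Nat.factorial_succ]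
    push_cast
    field_simp
    ring
  have h1 : Tendsto (fun n : ℕ => (a - b) / (b + n)) atTop (𝓝 0) :=
    tendsto_const_nhds.div_atTop
      (tendsto_atTop_add_const_left _ _ tendsto_natCast_atTop_atTop)
  have h2 : Tendsto (fun n : ℕ => z / ((n : ℝ) + 1)) atTop (𝓝 0) :=
    tendsto_const_nhds.div_atTop
      (tendsto_atTop_add_const_right _ _ tendsto_natCast_atTop_atTop)
  have h := ((h1.const_add 1).mul h2).norm
  rw [mul_zero, norm_zero] at h
  refine summable_of_ratio_norm_eventually_le (r := 1 / 2) (by norm_num) ?_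
  filter_upwards [h.eventually_le_const (by norm_num : (0 : ℝ) < 1 / 2)] with n hn
  rw [norm_norm, norm_norm, hratio, norm_mul]
  gcongr

theorem summable_kummerTerm (a z : ℝ) {b : ℝ} (hb : 0 < b) :
    Summable (kummerTerm a b z) :=
  (summable_norm_kummerTerm a z hb).of_norm

/-- Kummer's transformation. -/
theorem kummerM_eq_exp_mul (a z : ℝ) {b : ℝ} (hb : 0 < b) :
    kummerM a b z = Real.exp z * kummerM (b - a) b (-z) := by
  have hexp : Real.exp z = ∑' n : ℕ, z ^ n / (n.factorial : ℝ) := by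
    rw [Real.exp_eq_exp_ℝ, NormedSpace.exp_eq_tsum_div]
  change ∑' n, kummerTerm a b z n = Real.exp z * ∑' n, kummerTerm (b - a) b (-z) n
  rw [mul_comm, hexp, tsum_mul_tsum_eq_tsum_sum_antidiagonal_of_summable_norm
    (summable_norm_kummerTerm _ _ hb) (NormedSpace.norm_expSeries_div_summable z)]
  refine tsum_congr fun n => ?_
  have hv := sum_antidiagonal_choose_mul_ascPochhammer n b (b - a)
  rw [sub_sub_cancel] at hv
  rw [kummerTerm, ← hv, Finset.sum_div, Finset.sum_mul, Finset.sum_div]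
  refine Finset.sum_congr rfl fun p hp => ?_
  rw [← mem_antidiagonal.mp hp, kummerTerm, ← ascPochhammer_eval_mul_eval_add,
    Nat.cast_add_choose, neg_pow z, pow_add]
  have h1 := (ascPochhammer_pos p.1 b hb).ne'
  have h2 := (ascPochhammer_pos p.2 (b + p.1) (by positivity)).ne'
  field_simp

theorem one_le_kummerM {a b z : ℝ} (ha : 0 < a) (hb : 0 < b) (hz : 0 ≤ z) :
    1 ≤ kummerM a b z := by
  have h := (summable_kummerTerm a z hb).le_tsum 0 fun n _ => by
    have := ascPochhammer_pos n a ha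
    have := ascPochhammer_pos n b hb
    unfold kummerTerm
    positivity
  simpa [kummerTerm, kummerM] using h

theorem kummerM_le_kummerM {a b z w : ℝ} (ha : 0 < a) (hb : 0 < b) (hz : 0 ≤ z)
    (hzw : z ≤ w) : kummerM a b z ≤ kummerM a b w := by
  refine (summable_kummerTerm a z hb).tsum_le_tsum (fun n => ?_) (summable_kummerTerm a w hb)
  have := ascPochhammer_pos n a ha
  have := ascPochhammer_pos n b hb
  gcongr

/-- The Dirichlet equation has at most one positive root: its left side is strictly decreasing and
its right side nondecreasing on `(0, ∞)`. -/
theorem dirichlet_root_unique {a b C p : ℝ} (ha : 0 < a) (hb : 0 < b) (hC : 0 < C)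
    (hp : 0 ≤ p) {x y : ℝ} (hx : 0 < x) (hy : 0 < y)
    (hCx : C * (1 / (x * kummerM a b (x ^ 2))) = x ^ p)
    (hCy : C * (1 / (y * kummerM a b (y ^ 2))) = y ^ p) : x = y := by
  have key {s t : ℝ} (hs : 0 < s) (hst : s < t)
      (hCs : C * (1 / (s * kummerM a b (s ^ 2))) = s ^ p)
      (hCt : C * (1 / (t * kummerM a b (t ^ 2))) = t ^ p) : False := by
    have hM := one_le_kummerM ha hb (sq_nonneg s)
    have hM' : kummerM a b (s ^ 2) ≤ kummerM a b (t ^ 2) :=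
      kummerM_le_kummerM ha hb (sq_nonneg s) (by gcongr)
    have hlt : s * kummerM a b (s ^ 2) < t * kummerM a b (t ^ 2) := by nlinarith
    have hpos : 0 < s * kummerM a b (s ^ 2) := by positivity
    have h1 : C * (1 / (t * kummerM a b (t ^ 2))) < C * (1 / (s * kummerM a b (s ^ 2))) := by
      gcongr
    have h2 : s ^ p ≤ t ^ p := Real.rpow_le_rpow hs.le hst.le hp
    linarith
  rcases lt_trichotomy x y with h | h | h
  · exact (key hx h hCx hCy).elim
  · exact h
  · exact (key hy h hCy hCx).elim

/-- Equivalence of the Neumann and Dirichlet problems: if `ξ_N` is the positive root of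
the Neumann equation and `u₀ = (2aq₀/k)·ξ_N·M(−α/2+1/2,3/2,−ξ_N²)/M(−α/2,1/2,−ξ_N²)`,
then `ξ_N` is the unique positive root of the Dirichlet equation, i.e. `ξ_D = ξ_N`. -/
theorem stmt15 (β δ k a γ q₀ : ℝ) (hβ : β ≥ max δ (-1 - δ))
    (hk : 0 < k) (ha : 0 < a) (hγ : 0 < γ) (hq : 0 < q₀)
    (α : ℝ) (hα : α = β - δ)
    (ξN : ℝ) (hξpos : 0 < ξN)
    (hξ : (q₀ / (γ * (2:ℝ) ^ β * a ^ (β + δ + 1))) *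
      (1 / kummerM (α/2 + 1/2) (1/2) (ξN^2)) = ξN ^ (β + δ + 1))
    (u₀ : ℝ)
    (hu₀ : u₀ = (2 * a * q₀ / k) * ξN *
      (kummerM (-α/2 + 1/2) (3/2) (-ξN^2) / kummerM (-α/2) (1/2) (-ξN^2))) :
    ((k * u₀ / (γ * (2:ℝ) ^ (β + 1) * a ^ (β + δ + 2))) *
      (1 / (ξN * kummerM (α/2 + 1) (3/2) (ξN^2))) = ξN ^ (β + δ + 1)) ∧
    (∀ z : ℝ, 0 < z →
      (k * u₀ / (γ * (2:ℝ) ^ (β + 1) * a ^ (β + δ + 2))) *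
        (1 / (z * kummerM (α/2 + 1) (3/2) (z^2))) = z ^ (β + δ + 1) → z = ξN) := by
  have hα0 : 0 ≤ α := by
    rw [hα]
    linarith [le_max_left δ (-1 - δ)]
  have hp : 0 ≤ β + δ + 1 := by linarith [le_max_right δ (-1 - δ)]
  have hN := one_le_kummerM (a := α/2 + 1/2) (b := 1/2) (by positivity) (by norm_num)
    (sq_nonneg ξN)
  have hD := one_le_kummerM (a := α/2 + 1) (b := 3/2) (by positivity) (by norm_num)
    (sq_nonneg ξN)
  have hu : u₀ = (2 * a * q₀ / k) * ξN *
      (kummerM (α/2 + 1) (3/2) (ξN^2) / kummerM (α/2 + 1/2) (1/2) (ξN^2)) := by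
    rw [hu₀, kummerM_eq_exp_mul (α/2 + 1) (ξN^2) (b := 3/2) (by norm_num),
      kummerM_eq_exp_mul (α/2 + 1/2) (ξN^2) (b := 1/2) (by norm_num),
      mul_div_mul_left _ _ (Real.exp_ne_zero _)]
    ring_nf
  have hpos : 0 < k * u₀ / (γ * (2:ℝ) ^ (β + 1) * a ^ (β + δ + 2)) := by
    rw [hu]
    positivity
  have hroot : (k * u₀ / (γ * (2:ℝ) ^ (β + 1) * a ^ (β + δ + 2))) *
      (1 / (ξN * kummerM (α/2 + 1) (3/2) (ξN^2))) = ξN ^ (β + δ + 1) := by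
    rw [← hξ, hu, Real.rpow_add_one two_ne_zero,
      show β + δ + 2 = β + δ + 1 + 1 by ring, Real.rpow_add_one ha.ne' (β + δ + 1)]
    generalize kummerM (α/2 + 1/2) (1/2) (ξN^2) = M at hN ⊢
    generalize kummerM (α/2 + 1) (3/2) (ξN^2) = M' at hD ⊢
    field_simp
  exact ⟨hroot, fun z hz h =>
    dirichlet_root_unique (by positivity) (by norm_num) hpos hp hz hξpos h hroot⟩
end
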